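/- arXiv:cs/0510032 — 2 statements merged into one kernel-verified Lean document; each statement's English description precedes it below -/
import Mathlib

section
/- Let $A$ be a real $d\times n$ matrix with columns $a_1,\dots,a_n$, let $y\in\mathbb{R}^d$, and let $\tilde A=[A,-A]$ be the $d\times 2n$ matrix with columns $\tilde a_j=a_j$ for $1\le j\le n$ and $\tilde a_j=-a_{j-n}$ for $n+1\le j\le 2n$. Let $P=\operatorname{conv}\{\pm a_1,\dots,\pm a_n\}=\operatorname{conv}\{\tilde a_1,\dots,\tilde a_{2n}\}$. A set $F\subseteq P$ is a face of $P$ if $F=P$, or if $F=\{z\in P: w^Tz=b\}$ for some $w\in\mathbb{R}^d$, $b\in\mathbb{R}$ with $w^Tz\le b$ for all $z\in P$. Let $\tilde x_0\in\mathbb{R}^{2n}$ satisfy $\tilde x_0\ge 0$ and $\tilde A\tilde x_0=y$, with support $S$ of size $m\ge 1$, and let $F_{\mathrm{opt}}=\operatorname{conv}\{\tilde a_j: j\in S\}$. (a) Suppose that $\pm a_1,\dots,\pm a_n$ are $2n$ distinct vertices (extreme points) of $P$. Then $\tilde x_0$ is the unique minimizer of $\mathbf{1}^T\tilde x$ over $\{\tilde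 x\ge 0:\tilde A\tilde x=y\}$ if and only if the columns $\tilde a_j$, $j\in S$, are linearly independent and $F_{\mathrm{opt}}$ is a face of $P$. (b) For arbitrary $A$, $\tilde x_0$ is the unique minimizer of $\mathbf{1}^T\tilde x$ over $\{\tilde x\ge 0:\tilde A\tilde x=y\}$ if and only if the columns $\tilde a_j$, $j\in S$, are linearly independent, $F_{\mathrm{opt}}$ is a face of $P$, and $\tilde a_j\notin F_{\mathrm{opt}}$ for every $j\notin S$. (c) If the columns $\tilde a_j$, $j\in S$, are linearly independent and $F_{\mathrm{opt}}$ is a face of $P$, then $F_{\mathrm{opt}}$ is an $(m-1)$-simplex, that is, the convex hull of $m$ affinely independent points. -/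
open Matrix

/-- The doubled matrix `Ã = [A, −A]`; its `2n` columns are indexed by `Fin n ⊕ Fin n`, the left
copy for the columns `a_j` and the right copy for the columns `−a_j`. -/
def doubled {d n : ℕ} (A : Matrix (Fin d) (Fin n) ℝ) : Matrix (Fin d) (Fin n ⊕ Fin n) ℝ :=
  Matrix.fromCols A (-A)

/-- The `j`-th column `ã_j` of the doubled matrix. -/
def atom {d n : ℕ} (A : Matrix (Fin d) (Fin n) ℝ) (j : Fin n ⊕ Fin n) : Fin d → ℝ :=
  fun i => doubled A i j

/-- The centrally symmetric polytope `P = conv{±a_1, …, ±a_n}`. -/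
def atomPolytope {d n : ℕ} (A : Matrix (Fin d) (Fin n) ℝ) : Set (Fin d → ℝ) :=
  convexHull ℝ {v | ∃ j : Fin n, v = (fun i => A i j) ∨ v = -(fun i => A i j)}

/-- `conv{ã_j : j ∈ S}`. -/
def atomHull {d n : ℕ} (A : Matrix (Fin d) (Fin n) ℝ) (S : Finset (Fin n ⊕ Fin n)) :
    Set (Fin d → ℝ) :=
  convexHull ℝ {v | ∃ j ∈ S, v = atom A j}

/-- The feasible set `{x̃ ≥ 0 : Ã x̃ = y}`. -/
def feasible {d n : ℕ} (A : Matrix (Fin d) (Fin n) ℝ) (y : Fin d → ℝ) :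
    Set (Fin n ⊕ Fin n → ℝ) :=
  {xt | (∀ j, 0 ≤ xt j) ∧ doubled A *ᵥ xt = y}

/-- `xt` minimizes `1ᵀ x̃` over the feasible set. -/
def IsMinimizer {d n : ℕ} (A : Matrix (Fin d) (Fin n) ℝ) (y : Fin d → ℝ)
    (xt : Fin n ⊕ Fin n → ℝ) : Prop :=
  xt ∈ feasible A y ∧ ∀ zt ∈ feasible A y, ∑ j, xt j ≤ ∑ j, zt j

/-- `xt` is the unique minimizer of `1ᵀ x̃` over the feasible set. -/
def IsUniqueMinimizer {d n : ℕ} (A : Matrix (Fin d) (Fin n) ℝ) (y : Fin d → ℝ)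
    (xt : Fin n ⊕ Fin n → ℝ) : Prop :=
  IsMinimizer A y xt ∧ ∀ zt, IsMinimizer A y zt → zt = xt

/-- `F` is a face of `P`: either `F = P`, or `F` is the part of `P` on which a valid inequality
holds with equality. -/
def IsFace {d : ℕ} (P F : Set (Fin d → ℝ)) : Prop :=
  F = P ∨ ∃ (w : Fin d → ℝ) (b : ℝ), (∀ z ∈ P, w ⬝ᵥ z ≤ b) ∧ F = {z ∈ P | w ⬝ᵥ z = b}

/-- `F` is a `k`-simplex: the convex hull of `k + 1` affinely independent points. -/
def IsSimplexOfDim {d : ℕ} (k : ℕ) (F : Set (Fin d → ℝ)) : Prop :=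
  ∃ p : Fin (k + 1) → (Fin d → ℝ), AffineIndependent ℝ p ∧ F = convexHull ℝ (Set.range p)

/-- The signed columns `±a_1, …, ±a_n` are `2n` distinct vertices (extreme points) of `P`. -/
def HasAllVertices {d n : ℕ} (A : Matrix (Fin d) (Fin n) ℝ) : Prop :=
  Function.Injective (atom A) ∧ ∀ j, atom A j ∈ Set.extremePoints ℝ (atomPolytope A)

open Finset in
/-- If no nonzero `h` with `∑ h j • v j = 0` and `∑ h j ≤ 0` is nonnegative off `S`, then some
linear functional equals `1` on `v j` for `j ∈ S` and is smaller than `1` on the other `v j`. -/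
theorem exists_strict_dual_certificate {ι κ : Type*} [Fintype ι] [Fintype κ]
    (v : ι → κ → ℝ) (S : Finset ι)
    (h0 : ∀ h : ι → ℝ, ∑ j, h j • v j = 0 → ∑ j, h j ≤ 0 → (∀ j ∉ S, 0 ≤ h j) → h = 0) :
    ∃ w : κ → ℝ, (∀ j ∈ S, w ⬝ᵥ v j = 1) ∧ ∀ j ∉ S, w ⬝ᵥ v j < 1 := by
  classical
  let T : (Option ι → ℝ) →ₗ[ℝ] (κ → ℝ) × ℝ :=
    { toFun := fun p => (∑ j, p (some j) • v j, ∑ j, p (some j) + p none)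
      map_add' := fun p q => by
        ext <;> simp [add_smul, sum_add_distrib]
        ring
      map_smul' := fun c p => by
        ext <;> simp [mul_smul, smul_sum, mul_sum, mul_add] }
  let K : Set (Option ι → ℝ) := stdSimplex ℝ (Option ι) ∩ ⋂ j ∈ S, {p | p (some j) = 0}
  let L : Submodule ℝ (Option ι → ℝ) :=
    { carrier := {p | p none = 0 ∧ ∀ j ∉ S, p (some j) = 0}
      zero_mem' := by simp
      add_mem' := fun {p q} hp hq =>
        ⟨by simp [hp.1, hq.1], fun j hj => by simp [hp.2 j hj, hq.2 j hj]⟩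
      smul_mem' := fun c p hp => ⟨by simp [hp.1], fun j hj => by simp [hp.2 j hj]⟩ }
  have hKcomp : IsCompact K := (isCompact_stdSimplex ℝ (Option ι)).inter_right
    (isClosed_biInter fun j _ => isClosed_eq (continuous_apply _) continuous_const)
  have hKconv : Convex ℝ K := by
    refine (convex_stdSimplex ℝ (Option ι)).inter (convex_iInter₂ fun j _ => ?_)
    intro p hp q hq s t _ _ _
    simp_all
  have hT : Continuous T := T.continuous_of_finiteDimensional
  have hdisj : Disjoint (T '' K) (L.map T : Set ((κ → ℝ) × ℝ)) := by
    rw [Set.disjoint_left]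
    rintro _ ⟨p, ⟨⟨hp, hp1⟩, hpS⟩, rfl⟩ ⟨q, ⟨hq, hqS⟩, hqp⟩
    simp only [Set.mem_iInter, Set.mem_ofPred_eq] at hpS
    have e1 : ∑ j, q (some j) • v j = ∑ j, p (some j) • v j := congrArg Prod.fst hqp
    have e2 : ∑ j, q (some j) + q none = ∑ j, p (some j) + p none := congrArg Prod.snd hqp
    have hz := h0 (fun j => p (some j) - q (some j))
      (by simp [sub_smul, sum_sub_distrib, e1])
      (by rw [sum_sub_distrib]; linarith [hp none])
      (fun j hj => by simpa [hqS j hj] using hp (some j))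
    have hpz : ∀ j, p (some j) = 0 := fun j => by
      by_cases hj : j ∈ S
      · exact hpS j hj
      · have := congrFun hz j
        simpa [hqS j hj] using this
    have hqz : ∀ j, q (some j) = 0 := fun j => by
      have := congrFun hz j
      simpa [hpz j] using this
    rw [Fintype.sum_option] at hp1
    simp only [hpz, hqz, hq, sum_const_zero] at hp1 e2
    linarith
  obtain ⟨f, s, t, hs, hst, ht⟩ := geometric_hahn_banach_compact_closed
    (hKconv.linear_image T) (hKcomp.image hT) (L.map T).convex
    (L.map T).closed_of_finiteDimensional hdisj
  have ht0 : t < 0 := by simpa using ht 0 (Submodule.zero_mem _)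
  have hfL : ∀ x ∈ L.map T, f x = 0 := by
    intro x hx
    by_contra hne
    have := ht ((t / f x) • x) (Submodule.smul_mem _ _ hx)
    rw [map_smul, smul_eq_mul, div_mul_cancel₀ _ hne] at this
    exact lt_irrefl _ this
  have hfK : ∀ p ∈ K, f (T p) < 0 := fun p hp =>
    (hs _ (Set.mem_image_of_mem T hp)).trans (hst.trans ht0)
  have hTnone : T (Pi.single none 1) = (0, 1) := by simp [T]
  have hTsome : ∀ j, T (Pi.single (some j) 1) = (v j, 1) := by
    intro j
    simp [T, Pi.single_apply]
  have hβ : f (0, 1) < 0 := by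
    rw [← hTnone]
    exact hfK _ ⟨single_mem_stdSimplex ℝ _, by simp⟩
  have hS : ∀ j ∈ S, f (v j, 1) = 0 := by
    intro j hj
    rw [← hTsome]
    refine hfL _ (Submodule.mem_map_of_mem ⟨by simp, fun i hi => ?_⟩)
    have : i ≠ j := fun h => hi (h ▸ hj)
    simp [this]
  have hSc : ∀ j ∉ S, f (v j, 1) < 0 := by
    intro j hj
    rw [← hTsome]
    refine hfK _ ⟨single_mem_stdSimplex ℝ _, ?_⟩
    simp only [Set.mem_iInter, Set.mem_ofPred_eq]
    intro i hi
    have : i ≠ j := fun h => hj (h ▸ hi)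
    simp [this]
  have hf : ∀ u : κ → ℝ, f (u, 1) = (fun i => f (Pi.single i 1, 0)) ⬝ᵥ u + f (0, 1) := by
    intro u
    have h1 : (u, (1 : ℝ)) = ∑ i, u i • ((Pi.single i 1 : κ → ℝ), (0 : ℝ)) + (0, 1) := by
      ext <;> simp [Prod.fst_sum, Prod.snd_sum, Finset.sum_apply, Pi.single_apply]
    rw [h1, map_add, map_sum]
    simp only [map_smul, smul_eq_mul, dotProduct, mul_comm]
  refine ⟨(-f (0, 1))⁻¹ • fun i => f (Pi.single i 1, 0), fun j hj => ?_, fun j hj => ?_⟩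
  · have := hS j hj
    rw [hf] at this
    rw [smul_dotProduct, smul_eq_mul, inv_mul_eq_div, div_eq_one_iff_eq (by linarith)]
    linarith
  · have := hSc j hj
    rw [hf] at this
    rw [smul_dotProduct, smul_eq_mul, inv_mul_eq_div, div_lt_one (by linarith)]
    linarith

section Atoms

variable {d n : ℕ} (A : Matrix (Fin d) (Fin n) ℝ)

theorem doubled_mulVec_eq_sum (x : Fin n ⊕ Fin n → ℝ) :
    doubled A *ᵥ x = ∑ j, x j • atom A j := by
  ext i
  simp [mulVec, dotProduct, atom, Finset.sum_apply, mul_comm]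

theorem dotProduct_doubled_mulVec (w : Fin d → ℝ) (x : Fin n ⊕ Fin n → ℝ) :
    w ⬝ᵥ (doubled A *ᵥ x) = ∑ j, x j * (w ⬝ᵥ atom A j) := by
  simp [doubled_mulVec_eq_sum, dotProduct_sum]

theorem atom_inl (j : Fin n) : atom A (Sum.inl j) = fun i => A i j := rfl

theorem atom_inr (j : Fin n) : atom A (Sum.inr j) = -fun i => A i j := rfl

theorem atomPolytope_eq_atomHull_univ : atomPolytope A = atomHull A Finset.univ := by
  unfold atomPolytope atomHull
  congr 1
  ext v
  simp [atom_inl, atom_inr, exists_or]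

theorem atomHull_subset_atomPolytope (S : Finset (Fin n ⊕ Fin n)) :
    atomHull A S ⊆ atomPolytope A := by
  rw [atomPolytope_eq_atomHull_univ]
  exact convexHull_mono fun v ⟨j, _, hj⟩ => ⟨j, Finset.mem_univ j, hj⟩

theorem atom_mem_atomHull {S : Finset (Fin n ⊕ Fin n)} {j : Fin n ⊕ Fin n} (hj : j ∈ S) :
    atom A j ∈ atomHull A S :=
  subset_convexHull ℝ _ ⟨j, hj, rfl⟩

theorem atom_mem_atomPolytope (j : Fin n ⊕ Fin n) : atom A j ∈ atomPolytope A :=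
  atomHull_subset_atomPolytope A {j} (atom_mem_atomHull A (Finset.mem_singleton_self j))

theorem zero_mem_atomPolytope (j : Fin n ⊕ Fin n) : 0 ∈ atomPolytope A := by
  obtain ⟨k⟩ : Nonempty (Fin n) := j.elim (⟨·⟩) (⟨·⟩)
  have h := (convex_convexHull ℝ _) (atom_mem_atomPolytope A (Sum.inl k))
    (atom_mem_atomPolytope A (Sum.inr k)) (by norm_num : (0 : ℝ) ≤ 1 / 2)
    (by norm_num : (0 : ℝ) ≤ 1 / 2) (by norm_num)
  rwa [atom_inl, atom_inr, smul_neg, add_neg_cancel] at h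

theorem mem_atomHull_iff {S : Finset (Fin n ⊕ Fin n)} {z : Fin d → ℝ} :
    z ∈ atomHull A S ↔ ∃ c : Fin n ⊕ Fin n → ℝ, (∀ j, 0 ≤ c j) ∧ (∀ j ∉ S, c j = 0) ∧
      ∑ j, c j = 1 ∧ doubled A *ᵥ c = z := by
  constructor
  · intro hz
    refine convexHull_min (t := {z | ∃ c : Fin n ⊕ Fin n → ℝ, (∀ j, 0 ≤ c j) ∧
      (∀ j ∉ S, c j = 0) ∧ ∑ j, c j = 1 ∧ doubled A *ᵥ c = z}) ?_ ?_ hz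
    · rintro _ ⟨j, hj, rfl⟩
      refine ⟨Pi.single j 1, fun i => ?_, fun i hi => ?_, by simp, ?_⟩
      · rw [Pi.single_apply]; split_ifs <;> norm_num
      · have : i ≠ j := fun h => hi (h ▸ hj)
        exact Pi.single_eq_of_ne this _
      · exact mulVec_single_one _ _
    · rintro _ ⟨c, hc0, hcS, hc1, rfl⟩ _ ⟨e, he0, heS, he1, rfl⟩ s t hs ht hst
      refine ⟨s • c + t • e, fun j => ?_, fun j hj => by simp [hcS j hj, heS j hj], ?_, ?_⟩
      · exact add_nonneg (mul_nonneg hs (hc0 j)) (mul_nonneg ht (he0 j))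
      · simp [Finset.sum_add_distrib, ← Finset.mul_sum, hc1, he1, hst]
      · rw [mulVec_add, mulVec_smul, mulVec_smul]
  · rintro ⟨c, hc0, hcS, hc1, rfl⟩
    rw [doubled_mulVec_eq_sum,
      ← Finset.sum_subset S.subset_univ fun j _ hj => by rw [hcS j hj, zero_smul]]
    refine (convex_convexHull ℝ _).sum_mem (fun j _ => hc0 j) ?_ fun j hj =>
      atom_mem_atomHull A hj
    rw [← hc1]
    exact Finset.sum_subset S.subset_univ fun j _ hj => hcS j hj

theorem linearIndependent_atoms_iff (S : Finset (Fin n ⊕ Fin n)) :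
    LinearIndependent ℝ (fun j : S => atom A j.val) ↔
      ∀ c : Fin n ⊕ Fin n → ℝ, (∀ j ∉ S, c j = 0) → doubled A *ᵥ c = 0 → c = 0 := by
  change LinearIndepOn ℝ (atom A) (S : Set (Fin n ⊕ Fin n)) ↔ _
  rw [linearIndepOn_finset_iff]
  constructor
  · intro h c hc hA
    rw [doubled_mulVec_eq_sum,
      ← Finset.sum_subset S.subset_univ fun j _ hj => by rw [hc j hj, zero_smul]] at hA
    ext j
    by_cases hj : j ∈ S
    · exact h c hA j hj
    · exact hc j hj
  · intro h c hA j hj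
    have := congrFun (h (fun i => if i ∈ S then c i else 0) (fun i hi => if_neg hi) (by
      simpa [doubled_mulVec_eq_sum, ite_smul] using hA)) j
    simpa [hj] using this

variable {A} {y : Fin d → ℝ} {x : Fin n ⊕ Fin n → ℝ} {S : Finset (Fin n ⊕ Fin n)}

theorem zero_notMem_atomHull (hli : LinearIndependent ℝ (fun j : S => atom A j.val)) :
    0 ∉ atomHull A S := by
  rw [mem_atomHull_iff]
  rintro ⟨c, -, hcS, hc1, hc⟩
  simp [(linearIndependent_atoms_iff A S).1 hli c hcS hc] at hc1

/-- A direction `h` along which the objective does not increase, and which is nonnegative off the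
support of the unique minimizer, vanishes. -/
theorem IsUniqueMinimizer.direction_eq_zero (hx : IsUniqueMinimizer A y x)
    (hS : ∀ j, j ∈ S ↔ x j ≠ 0) {h : Fin n ⊕ Fin n → ℝ} (hA : doubled A *ᵥ h = 0)
    (hsum : ∑ j, h j ≤ 0) (hh : ∀ j ∉ S, 0 ≤ h j) : h = 0 := by
  obtain ⟨⟨⟨hpos, hy⟩, hmin⟩, huniq⟩ := hx
  obtain ⟨ε, hε, hεx⟩ : ∃ ε > 0, ∀ j, 0 ≤ x j + ε * h j := by
    have hev : ∀ j, ∀ᶠ ε : ℝ in nhdsWithin 0 (Set.Ioi 0), 0 ≤ x j + ε * h j := by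
      intro j
      by_cases hj : j ∈ S
      · have hxj : 0 < x j := (hpos j).lt_of_ne' ((hS j).1 hj)
        have hc : Continuous fun ε : ℝ => x j + ε * h j := by fun_prop
        refine (hc.tendsto 0).mono_left nhdsWithin_le_nhds |>.eventually_const_le ?_
        simpa using hxj
      · filter_upwards [self_mem_nhdsWithin] with ε hε
        exact add_nonneg (hpos j) (mul_nonneg (le_of_lt hε) (hh j hj))
    obtain ⟨ε, h1, h2⟩ := ((Filter.eventually_all.2 hev).and self_mem_nhdsWithin).exists
    exact ⟨ε, h2, h1⟩
  have hfeas : x + ε • h ∈ feasible A y :=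
    ⟨hεx, by rw [mulVec_add, mulVec_smul, hA, smul_zero, add_zero, hy]⟩
  have hle : ∑ j, (x + ε • h) j ≤ ∑ j, x j := by
    simp only [Pi.add_apply, Pi.smul_apply, smul_eq_mul, Finset.sum_add_distrib,
      ← Finset.mul_sum]
    linarith [mul_nonpos_of_nonneg_of_nonpos hε.le hsum]
  have := huniq _ ⟨hfeas, fun z hz => hle.trans (hmin z hz)⟩
  rw [add_eq_left] at this
  exact (smul_eq_zero.1 this).resolve_left (ne_of_gt hε)

/-- Uniqueness of the minimizer is equivalent to a strictly complementary dual certificate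
together with linear independence of the active columns. -/
theorem isUniqueMinimizer_iff_certificate (hpos : ∀ j, 0 ≤ x j) (hy : doubled A *ᵥ x = y)
    (hS : ∀ j, j ∈ S ↔ x j ≠ 0) :
    IsUniqueMinimizer A y x ↔ LinearIndependent ℝ (fun j : S => atom A j.val) ∧
      ∃ w : Fin d → ℝ, (∀ j ∈ S, w ⬝ᵥ atom A j = 1) ∧ ∀ j ∉ S, w ⬝ᵥ atom A j < 1 := by
  constructor
  · intro hx
    refine ⟨(linearIndependent_atoms_iff A S).2 fun c hcS hc => ?_,
      exists_strict_dual_certificate (atom A) S fun h hA hsum hh =>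
        hx.direction_eq_zero hS (by rwa [doubled_mulVec_eq_sum]) hsum hh⟩
    rcases le_total (∑ j, c j) 0 with hs | hs
    · exact hx.direction_eq_zero hS hc hs fun j hj => (hcS j hj).ge
    · have := hx.direction_eq_zero hS (h := -c) (by rw [mulVec_neg, hc, neg_zero])
        (by simpa only [Pi.neg_apply, Finset.sum_neg_distrib, neg_nonpos] using hs) fun j hj => by simp [hcS j hj]
      simpa using this
  · rintro ⟨hli, w, hwS, hwSc⟩
    have hw : ∀ j, w ⬝ᵥ atom A j ≤ 1 := fun j => by
      by_cases hj : j ∈ S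
      · exact (hwS j hj).le
      · exact (hwSc j hj).le
    have hterm : ∀ z ∈ feasible A y, ∀ j, z j * (w ⬝ᵥ atom A j) ≤ z j := fun z hz j =>
      mul_le_of_le_one_right (hz.1 j) (hw j)
    have hbound : ∀ z ∈ feasible A y, w ⬝ᵥ y ≤ ∑ j, z j := by
      intro z hz
      rw [← hz.2, dotProduct_doubled_mulVec]
      exact Finset.sum_le_sum fun j _ => hterm z hz j
    have hval : ∑ j, x j = w ⬝ᵥ y := by
      rw [← hy, dotProduct_doubled_mulVec]
      refine Finset.sum_congr rfl fun j _ => ?_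
      by_cases hj : j ∈ S
      · rw [hwS j hj, mul_one]
      · rw [not_not.1 (mt (hS j).2 hj), zero_mul]
    refine ⟨⟨⟨hpos, hy⟩, fun z hz => hval.trans_le (hbound z hz)⟩, fun z hz => ?_⟩
    have heq : ∑ j, z j * (w ⬝ᵥ atom A j) = ∑ j, z j := by
      rw [← dotProduct_doubled_mulVec, hz.1.2, ← hval]
      exact le_antisymm (hval.trans_le (hbound z hz.1)) (hz.2 x ⟨hpos, hy⟩)
    have hz0 : ∀ j ∉ S, z j = 0 := by
      intro j hj
      have h1 := (Finset.sum_eq_sum_iff_of_le fun j _ => hterm z hz.1 j).1 heq j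
        (Finset.mem_univ j)
      by_contra hne
      exact (hwSc j hj).ne ((mul_eq_left₀ hne).1 h1)
    refine sub_eq_zero.1 ((linearIndependent_atoms_iff A S).1 hli (z - x) (fun j hj => ?_) ?_)
    · rw [Pi.sub_apply, hz0 j hj, not_not.1 (mt (hS j).2 hj), sub_zero]
    · rw [mulVec_sub, hz.1.2, hy, sub_self]

/-- For linearly independent columns, a strictly complementary certificate exists exactly when
their hull is a face of the polytope containing no other column. -/
theorem certificate_iff_isFace (hli : LinearIndependent ℝ (fun j : S => atom A j.val))
    (hne : S.Nonempty) :
    (∃ w : Fin d → ℝ, (∀ j ∈ S, w ⬝ᵥ atom A j = 1) ∧ ∀ j ∉ S, w ⬝ᵥ atom A j < 1) ↔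
      IsFace (atomPolytope A) (atomHull A S) ∧ ∀ j, j ∉ S → atom A j ∉ atomHull A S := by
  obtain ⟨j₀, hj₀⟩ := hne
  constructor
  · rintro ⟨w, hwS, hwSc⟩
    have hw : ∀ j, w ⬝ᵥ atom A j ≤ 1 := fun j => by
      by_cases hj : j ∈ S
      · exact (hwS j hj).le
      · exact (hwSc j hj).le
    have hface : atomHull A S = {z ∈ atomPolytope A | w ⬝ᵥ z = 1} := by
      ext z
      refine ⟨fun hz => ⟨atomHull_subset_atomPolytope A S hz, ?_⟩, fun ⟨hz, hwz⟩ => ?_⟩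
      · obtain ⟨c, hc0, hcS, hc1, rfl⟩ := (mem_atomHull_iff A).1 hz
        rw [dotProduct_doubled_mulVec, ← hc1]
        refine Finset.sum_congr rfl fun j _ => ?_
        by_cases hj : j ∈ S
        · rw [hwS j hj, mul_one]
        · rw [hcS j hj, zero_mul]
      · rw [atomPolytope_eq_atomHull_univ, mem_atomHull_iff] at hz
        obtain ⟨c, hc0, -, hc1, rfl⟩ := hz
        refine (mem_atomHull_iff A).2 ⟨c, hc0, fun j hj => ?_, hc1, rfl⟩
        rw [dotProduct_doubled_mulVec, ← hc1] at hwz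
        have h1 := (Finset.sum_eq_sum_iff_of_le fun j _ =>
          mul_le_of_le_one_right (hc0 j) (hw j)).1 hwz j (Finset.mem_univ j)
        by_contra hne
        exact (hwSc j hj).ne ((mul_eq_left₀ hne).1 h1)
    refine ⟨Or.inr ⟨w, 1, fun z hz => ?_, hface⟩, fun j hj hmem => ?_⟩
    · rw [atomPolytope_eq_atomHull_univ, mem_atomHull_iff] at hz
      obtain ⟨c, hc0, -, hc1, rfl⟩ := hz
      rw [dotProduct_doubled_mulVec, ← hc1]
      exact Finset.sum_le_sum fun j _ => mul_le_of_le_one_right (hc0 j) (hw j)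
    · rw [hface] at hmem
      exact (hwSc j hj).ne hmem.2
  · rintro ⟨hface, hout⟩
    have h0P : (0 : Fin d → ℝ) ∈ atomPolytope A := zero_mem_atomPolytope A j₀
    have h0F := zero_notMem_atomHull hli
    obtain hP | ⟨w, b, hwb, hF⟩ := hface
    · exact absurd (hP ▸ h0P) h0F
    have hb : 0 < b := by
      refine lt_of_le_of_ne (by simpa using hwb 0 h0P) fun hb => h0F ?_
      rw [hF]
      exact ⟨h0P, by simpa using hb⟩
    refine ⟨b⁻¹ • w, fun j hj => ?_, fun j hj => ?_⟩
    · have h1 := atom_mem_atomHull A hj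
      rw [hF] at h1
      rw [smul_dotProduct, h1.2, smul_eq_mul, inv_mul_cancel₀ hb.ne']
    · have hjP := atom_mem_atomPolytope A j
      have hlt : w ⬝ᵥ atom A j < b := lt_of_le_of_ne (hwb _ hjP) fun h =>
        hout j hj (by rw [hF]; exact ⟨hjP, h⟩)
      rwa [smul_dotProduct, smul_eq_mul, inv_mul_eq_div, div_lt_one hb]

theorem HasAllVertices.atom_notMem_atomHull (hA : HasAllVertices A) {j : Fin n ⊕ Fin n}
    (hj : j ∉ S) : atom A j ∉ atomHull A S := by
  intro hmem
  obtain ⟨i, hi, hij⟩ := extremePoints_convexHull_subset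
    (inter_extremePoints_subset_extremePoints_of_subset (atomHull_subset_atomPolytope A S)
      ⟨hmem, hA.2 j⟩)
  exact hj (hA.1 hij ▸ hi)

theorem isSimplexOfDim_atomHull (hli : LinearIndependent ℝ (fun j : S => atom A j.val))
    {k : ℕ} (hk : S.card = k + 1) : IsSimplexOfDim k (atomHull A S) := by
  have e : Fin (k + 1) ≃ S := (S.equivFinOfCardEq hk).symm
  refine ⟨fun i => atom A (e i).val, hli.affineIndependent.comp_embedding e.toEmbedding, ?_⟩
  unfold atomHull
  congr 1
  ext v
  simp only [Set.mem_ofPred_eq, Set.mem_range, e.exists_congr_left, Equiv.apply_symm_apply]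
  simp [eq_comm]

end Atoms

/-- Let `x̃0 ≥ 0` solve `Ã x̃0 = y`, with support `S` of size `m ≥ 1`, and let
`F_opt = conv{ã_j : j ∈ S}`.
* If `±a_1, …, ±a_n` are `2n` distinct vertices of `P`, then `x̃0` is the unique minimizer of
  `1ᵀ x̃` iff the columns `ã_j`, `j ∈ S`, are linearly independent and `F_opt` is a face of `P`.
* For arbitrary `A`, the same equivalence holds once the right-hand side also asks that no column
  `ã_j` with `j ∉ S` lies in `F_opt`.
* When those columns are linearly independent and `F_opt` is a face, `F_opt` is an
  `(m-1)`-simplex. -/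
theorem unique_iff_primal_face {d n : ℕ} (A : Matrix (Fin d) (Fin n) ℝ) (y : Fin d → ℝ)
    (xt0 : Fin n ⊕ Fin n → ℝ) (S : Finset (Fin n ⊕ Fin n)) (m : ℕ)
    (hpos : ∀ j, 0 ≤ xt0 j) (hy : doubled A *ᵥ xt0 = y)
    (hS : ∀ j, j ∈ S ↔ xt0 j ≠ 0) (hcard : S.card = m) (hm : 1 ≤ m) :
    (HasAllVertices A →
      (IsUniqueMinimizer A y xt0 ↔
        LinearIndependent ℝ (fun j : S => atom A j.val) ∧
          IsFace (atomPolytope A) (atomHull A S))) ∧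
    (IsUniqueMinimizer A y xt0 ↔
      LinearIndependent ℝ (fun j : S => atom A j.val) ∧
        IsFace (atomPolytope A) (atomHull A S) ∧
        ∀ j, j ∉ S → atom A j ∉ atomHull A S) ∧
    (LinearIndependent ℝ (fun j : S => atom A j.val) ∧
        IsFace (atomPolytope A) (atomHull A S) →
      IsSimplexOfDim (m - 1) (atomHull A S)) := by
  have hne : S.Nonempty := Finset.card_pos.1 (by omega)
  have hb : IsUniqueMinimizer A y xt0 ↔
      LinearIndependent ℝ (fun j : S => atom A j.val) ∧
        IsFace (atomPolytope A) (atomHull A S) ∧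
        ∀ j, j ∉ S → atom A j ∉ atomHull A S := by
    rw [isUniqueMinimizer_iff_certificate hpos hy hS]
    exact and_congr_right fun hli => certificate_iff_isFace hli hne
  refine ⟨fun hA => hb.trans ?_, hb, fun h => isSimplexOfDim_atomHull h.1 (by omega)⟩
  exact and_congr_right fun _ =>
    and_iff_left fun j hj => hA.atom_notMem_atomHull hj
end

section
/- Let $A$ be a real $d\times n$ matrix with columns $a_1,\dots,a_n$, let $y\in\mathbb{R}^d$, and let $P=\operatorname{conv}\{\pm a_1,\dots,\pm a_n\}\subset\mathbb{R}^d$. Let $\operatorname{Spark}(A)$ be the smallest number $\sigma$ such that some set of $\sigma$ columns of $A$ is linearly dependent ($\operatorname{Spark}(A)=\infty$ if there is no such set). A subset $F\subseteq P$ is a face of $P$ if $F=P$ or if $F=\{z\in P: w^{T}z=b\}$ for some $w\in\mathbb{R}^d$, $b\in\mathbb{R}$ with $w^{T}z\le b$ for all $z\in P$. For $0\le k\le n$, $P$ is called $k$-neighbourly if for all indices $i_1<\dots<i_k$ and all signs $\sigma_1,\dots,\sigma_k\in\{-1,+1\}$ the points $\sigma_1a_{i_1},\dots,\sigma_ka_{i_k}$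 are affinely independent and their convex hull is a face of $P$. Let $k\le n$ and suppose that $P$ is $k$-neighbourly. If $x_0\in\mathbb{R}^n$ satisfies $Ax_0=y$ and has $m$ nonzero entries, where $m\le k$ and $2m<\operatorname{Spark}(A)$, then $x_0$ is simultaneously the unique sparsest solution of $Ax=y$ (every other solution has more than $m$ nonzero entries) and the unique minimizer of $\|x\|_1$ over $\{x\in\mathbb{R}^n: Ax=y\}$ (that is, $\ell_1/\ell_0$-equivalence holds for $x_0$). -/
open Matrix

/-- `spark A`: the smallest number `σ` such that some set of `σ` columns of `A` is linearly
dependent (`⊤` if all columns together are linearly independent, so that no such set exists). -/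
noncomputable def spark {d n : ℕ} (A : Matrix (Fin d) (Fin n) ℝ) : ℕ∞ :=
  sInf {σ : ℕ∞ | ∃ s : Finset (Fin n), (s.card : ℕ∞) = σ ∧
    ¬ LinearIndependent ℝ (fun j : s => A.transpose j.val)}

/-- The centrally symmetric polytope `P = conv{±a_1, …, ±a_n}`. -/
def signedAtomPolytope {d n : ℕ} (A : Matrix (Fin d) (Fin n) ℝ) : Set (Fin d → ℝ) :=
  convexHull ℝ {v | ∃ i, v = A.transpose i ∨ v = -(A.transpose i)}

/-- `P = conv{±a_1, …, ±a_n}` is `k`-neighbourly: any `k` atoms with distinct indices, with any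
signs, are the vertices of a simplex that is a face of `P`. The notion is meant for `k ≤ n`; for
`k > n` there is no choice of `k` distinct indices. -/
def Neighbourly {d n : ℕ} (A : Matrix (Fin d) (Fin n) ℝ) (k : ℕ) : Prop :=
  ∀ s : Finset (Fin n), s.card = k → ∀ σ : Fin n → ℝ, (∀ i ∈ s, σ i = 1 ∨ σ i = -1) →
    AffineIndependent ℝ (fun i : s => σ i.val • A.transpose i.val) ∧
    IsFace (signedAtomPolytope A) (convexHull ℝ {v | ∃ i ∈ s, v = σ i • A.transpose i})

theorem eq_zero_of_card_lt_spark {d n : ℕ} (A : Matrix (Fin d) (Fin n) ℝ) (c : Fin n → ℝ)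
    (T : Finset (Fin n)) (hc : ∑ i, c i • A.transpose i = 0) (hT : ∀ i, i ∉ T → c i = 0)
    (hlt : (T.card : ℕ∞) < spark A) : c = 0 := by
  have hli : LinearIndependent ℝ (fun j : T => A.transpose j.val) := by
    by_contra h
    exact absurd hlt (not_lt.mpr (sInf_le ⟨T, rfl, h⟩))
  rw [Fintype.linearIndependent_iff] at hli
  have hsum : ∑ i : T, c i.val • A.transpose i.val = 0 := by
    rw [Finset.sum_coe_sort T (fun i => c i • A.transpose i), ← hc]
    refine Finset.sum_subset (Finset.subset_univ _) fun i _ hi => ?_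
    rw [hT i hi, zero_smul]
  funext i
  by_cases hi : i ∈ T
  · exact hli (fun j => c j.val) hsum ⟨i, hi⟩
  · exact hT i hi

theorem exists_weights_of_mem_convexHull {ι E : Type*} [Fintype ι] [DecidableEq ι]
    [AddCommGroup E] [Module ℝ E] (s : Finset ι) (p : ι → E) {z : E}
    (hz : z ∈ convexHull ℝ {v | ∃ i ∈ s, v = p i}) :
    ∃ w : ι → ℝ, (∀ i, 0 ≤ w i) ∧ (∀ i, i ∉ s → w i = 0) ∧ ∑ i, w i = 1 ∧
      ∑ i, w i • p i = z := by
  let C : Set E := {z | ∃ w : ι → ℝ, (∀ i, 0 ≤ w i) ∧ (∀ i, i ∉ s → w i = 0) ∧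
    ∑ i, w i = 1 ∧ ∑ i, w i • p i = z}
  refine convexHull_min (t := C) ?_ ?_ hz
  · rintro v ⟨i, hi, rfl⟩
    refine ⟨Pi.single i 1, fun j => ?_, fun j hj => ?_, ?_, ?_⟩
    · by_cases h : j = i
      · subst h; simp
      · simp [h]
    · have h : j ≠ i := fun h => hj (h ▸ hi)
      simp [h]
    · simp
    · simp [Pi.single_apply, ite_smul]
  · rintro u ⟨f, hf, hfs, hf1, rfl⟩ v ⟨g, hg, hgs, hg1, rfl⟩ a b ha hb hab
    refine ⟨fun i => a * f i + b * g i, fun i => ?_, fun i hi => ?_, ?_, ?_⟩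
    · exact add_nonneg (mul_nonneg ha (hf i)) (mul_nonneg hb (hg i))
    · simp [hfs i hi, hgs i hi]
    · rw [Finset.sum_add_distrib, ← Finset.mul_sum, ← Finset.mul_sum, hf1, hg1]
      simpa using hab
    · simp only [add_smul, mul_smul, Finset.sum_add_distrib, Finset.smul_sum]

theorem AffineIndependent.weights_unique {ι E : Type*} [Fintype ι]
    [AddCommGroup E] [Module ℝ E] {s : Finset ι} {p : ι → E}
    (hp : AffineIndependent ℝ (fun i : s => p i.val)) {u v : ι → ℝ}
    (hu : ∀ i, i ∉ s → u i = 0) (hv : ∀ i, i ∉ s → v i = 0)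
    (hsum : ∑ i, u i = ∑ i, v i) (hcomb : ∑ i, u i • p i = ∑ i, v i • p i) : u = v := by
  rw [affineIndependent_iff] at hp
  have h1 : ∑ i : s, (u i.val - v i.val) = 0 := by
    rw [Finset.sum_coe_sort s (fun i => u i - v i),
      Finset.sum_subset (Finset.subset_univ s) fun i _ hi => by rw [hu i hi, hv i hi, sub_zero],
      Finset.sum_sub_distrib, hsum, sub_self]
  have h2 : ∑ i : s, (u i.val - v i.val) • p i.val = 0 := by
    rw [Finset.sum_coe_sort s (fun i => (u i - v i) • p i),
      Finset.sum_subset (Finset.subset_univ s) fun i _ hi => by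
        rw [hu i hi, hv i hi, sub_zero, zero_smul]]
    simp only [sub_smul]
    rw [Finset.sum_sub_distrib, hcomb, sub_self]
  funext i
  by_cases hi : i ∈ s
  · exact sub_eq_zero.mp (hp Finset.univ (fun j => u j.val - v j.val) h1 h2 ⟨i, hi⟩
      (Finset.mem_univ _))
  · rw [hu i hi, hv i hi]

theorem smul_atom_mem_signedAtomPolytope {d n : ℕ} (A : Matrix (Fin d) (Fin n) ℝ) (i : Fin n)
    {ε : ℝ} (hε : ε = 1 ∨ ε = -1) : ε • A.transpose i ∈ signedAtomPolytope A := by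
  refine subset_convexHull ℝ _ ⟨i, ?_⟩
  rcases hε with rfl | rfl <;> simp

/-- A simplex on signed atoms does not contain all the antipodes of its vertices, as soon as any
two atoms are linearly independent. -/
theorem exists_neg_notMem_convexHull {d n : ℕ} (A : Matrix (Fin d) (Fin n) ℝ)
    {s : Finset (Fin n)} (hs : s.Nonempty) {σ : Fin n → ℝ} (hσ : ∀ i, σ i = 1 ∨ σ i = -1)
    (haff : AffineIndependent ℝ (fun i : s => σ i.val • A.transpose i.val))
    (hspark : 2 < spark A) :
    ∃ i ∈ s, -(σ i • A.transpose i) ∉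
      convexHull ℝ {v | ∃ i ∈ s, v = σ i • A.transpose i} := by
  by_contra! hall
  obtain ⟨i, hi⟩ := hs
  obtain ⟨f, hf, hfs, hf1, hfc⟩ :=
    exists_weights_of_mem_convexHull s (fun i => σ i • A.transpose i) (hall i hi)
  have key : ∃ j, -(σ i • A.transpose i) = σ j • A.transpose j := by
    by_cases h : ∃ j ∈ s, j ≠ i
    · obtain ⟨j, hj, hji⟩ := h
      obtain ⟨g, hg, hgs, hg1, hgc⟩ :=
        exists_weights_of_mem_convexHull s (fun i => σ i • A.transpose i) (hall j hj)
      have heq : f + Pi.single i 1 = g + Pi.single j 1 := by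
        refine haff.weights_unique (p := fun i => σ i • A.transpose i) (fun l hl => ?_)
          (fun l hl => ?_) ?_ ?_
        · have : l ≠ i := fun h => hl (h ▸ hi)
          simp [hfs l hl, this]
        · have : l ≠ j := fun h => hl (h ▸ hj)
          simp [hgs l hl, this]
        · simp [Finset.sum_add_distrib, hf1, hg1]
        · simp only [Pi.add_apply, add_smul, Finset.sum_add_distrib, hfc, hgc]
          simp [Pi.single_apply, ite_smul]
      have hfj : 1 ≤ f j := by
        have := congrFun heq j
        simp [hji] at this
        linarith [hg j]
      have hsplit := Finset.add_sum_erase Finset.univ f (Finset.mem_univ j)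
      have hrest : ∑ l ∈ Finset.univ.erase j, f l = 0 :=
        le_antisymm (by linarith) (Finset.sum_nonneg fun l _ => hf l)
      have hzero := (Finset.sum_eq_zero_iff_of_nonneg fun l _ => hf l).mp hrest
      refine ⟨j, ?_⟩
      rw [← hfc, Finset.sum_eq_single j]
      · rw [show f j = 1 by linarith, one_smul]
      · intro l _ hl
        rw [hzero l (by simp [hl]), zero_smul]
      · simp
    · push Not at h
      have hz : ∀ l, l ≠ i → f l = 0 := fun l hl => hfs l fun h' => hl (h l h')
      refine ⟨i, ?_⟩
      rw [Fintype.sum_eq_single i hz] at hf1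
      rw [← hfc, Finset.sum_eq_single i]
      · rw [hf1, one_smul]
      · intro l _ hl
        rw [hz l hl, zero_smul]
      · simp
  obtain ⟨j, hj⟩ := key
  have hc := eq_zero_of_card_lt_spark A (Pi.single i (σ i) + Pi.single j (σ j)) {i, j}
    (by simp [add_smul, Finset.sum_add_distrib, Pi.single_apply, ite_smul, ← hj])
    (by intro l hl; simp at hl; simp [hl])
    (lt_of_le_of_lt (by exact_mod_cast Finset.card_le_two) hspark)
  have hci := congrFun hc i
  rcases eq_or_ne j i with rfl | hji
  · rcases hσ j with h | h <;> simp [h] at hci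
  · rcases hσ i with h | h <;> simp [h, hji.symm] at hci

/-- The simplex on `k` signed atoms of a `k`-neighbourly polytope is cut out by a hyperplane that
does not pass through the origin. -/
theorem Neighbourly.exists_supporting {d n k : ℕ} {A : Matrix (Fin d) (Fin n) ℝ}
    (hnb : Neighbourly A k) {s : Finset (Fin n)} (hsk : s.card = k) (hs : s.Nonempty)
    {σ : Fin n → ℝ} (hσ : ∀ i, σ i = 1 ∨ σ i = -1) (hspark : 2 < spark A) :
    ∃ (w : Fin d → ℝ) (b : ℝ), 0 < b ∧
      (∀ i ∈ s, w ⬝ᵥ (σ i • A.transpose i) = b) ∧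
      (∀ (ε : ℝ) (j : Fin n), ε = 1 ∨ ε = -1 → w ⬝ᵥ (ε • A.transpose j) ≤ b ∧
        (w ⬝ᵥ (ε • A.transpose j) = b →
          ε • A.transpose j ∈ convexHull ℝ {v | ∃ i ∈ s, v = σ i • A.transpose i})) := by
  obtain ⟨haff, hface⟩ := hnb s hsk σ fun i _ => hσ i
  obtain ⟨i, hi, hneg⟩ := exists_neg_notMem_convexHull A hs hσ haff hspark
  have hnegP : -(σ i • A.transpose i) ∈ signedAtomPolytope A := by
    rw [← neg_smul]
    refine smul_atom_mem_signedAtomPolytope A i ?_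
    rcases hσ i with h | h <;> simp [h]
  rcases hface with hF | ⟨w, b, hle, hF⟩
  · exact absurd (hF ▸ hnegP) hneg
  have hon : ∀ i ∈ s, w ⬝ᵥ (σ i • A.transpose i) = b := fun i hi => by
    have : σ i • A.transpose i ∈ convexHull ℝ {v | ∃ i ∈ s, v = σ i • A.transpose i} :=
      subset_convexHull ℝ _ ⟨i, hi, rfl⟩
    rw [hF] at this
    exact this.2
  refine ⟨w, b, ?_, hon, fun ε j hε => ⟨hle _ (smul_atom_mem_signedAtomPolytope A j hε),
    fun h => hF ▸ ⟨smul_atom_mem_signedAtomPolytope A j hε, h⟩⟩⟩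
  by_contra hb
  refine hneg (hF ▸ ⟨hnegP, le_antisymm (hle _ hnegP) ?_⟩)
  rw [dotProduct_neg, hon i hi]
  linarith

theorem exists_sign_mul_abs {ι : Type*} (x : ι → ℝ) :
    ∃ σ : ι → ℝ, (∀ i, σ i = 1 ∨ σ i = -1) ∧ ∀ i, |x i| * σ i = x i := by
  refine ⟨fun i => if x i < 0 then -1 else 1, fun i => ?_, fun i => ?_⟩
  · by_cases h : x i < 0 <;> simp [h]
  · by_cases h : x i < 0
    · simp [h, abs_of_neg h]
    · simp [h, abs_of_nonneg (not_lt.mp h)]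

/-- A solution whose `ℓ1` norm does not exceed that of a sparse solution `x0` is supported on the
support of `x0`. -/
theorem support_subset_of_sum_abs_le {d n k m : ℕ} {A : Matrix (Fin d) (Fin n) ℝ}
    (hkn : k ≤ n) (hnb : Neighbourly A k) {x0 x : Fin n → ℝ}
    (hx : ∑ i, x i • A.transpose i = ∑ i, x0 i • A.transpose i)
    (hm : (Finset.univ.filter fun i => x0 i ≠ 0).card = m) (hmk : m ≤ k) (hm0 : 0 < m)
    (hspark : ((2 * m : ℕ) : ℕ∞) < spark A) (hle : ∑ i, |x i| ≤ ∑ i, |x0 i|) :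
    ∀ j, x0 j = 0 → x j = 0 := by
  obtain ⟨s, hTs, hsk⟩ := Finset.exists_superset_card_eq (hm.trans_le hmk) (by simpa using hkn)
  have hs0 : ∀ i, i ∉ s → x0 i = 0 := fun i hi => by
    by_contra h
    exact hi (hTs (by simp [h]))
  have hs : s.Nonempty := by
    rw [← Finset.card_pos]; omega
  obtain ⟨σ, hσ, hσx⟩ := exists_sign_mul_abs x0
  obtain ⟨τ, hτ, hτx⟩ := exists_sign_mul_abs x
  have hspark2 : 2 < spark A :=
    lt_of_le_of_lt (by exact_mod_cast (by omega : 2 ≤ 2 * m)) hspark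
  have haff := (hnb s hsk σ fun i _ => hσ i).1
  obtain ⟨w, b, hb, hon, hval⟩ := hnb.exists_supporting hsk hs hσ hspark2
  have hx' : ∑ i, |x i| • (τ i • A.transpose i) = ∑ i, |x0 i| • (σ i • A.transpose i) := by
    simpa only [smul_smul, hσx, hτx] using hx
  have hw0 : w ⬝ᵥ (∑ i, |x0 i| • (σ i • A.transpose i)) = b * ∑ i, |x0 i| := by
    rw [dotProduct_sum, Finset.mul_sum]
    refine Finset.sum_congr rfl fun i _ => ?_
    rw [dotProduct_smul, smul_eq_mul]
    by_cases hi : i ∈ s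
    · rw [hon i hi, mul_comm]
    · simp [hs0 i hi]
  have hgap : ∑ i, |x i| * (b - w ⬝ᵥ (τ i • A.transpose i)) =
      b * (∑ i, |x i| - ∑ i, |x0 i|) := by
    have hw : ∑ i, |x i| * (w ⬝ᵥ (τ i • A.transpose i)) = b * ∑ i, |x0 i| := by
      rw [← hw0, ← hx', dotProduct_sum]
      refine Finset.sum_congr rfl fun i _ => ?_
      rw [dotProduct_smul |x i|, smul_eq_mul]
    simp only [mul_sub, Finset.sum_sub_distrib, hw]
    rw [← Finset.sum_mul, mul_comm]
  have hnn : ∀ i ∈ Finset.univ, 0 ≤ |x i| * (b - w ⬝ᵥ (τ i • A.transpose i)) := fun i _ =>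
    mul_nonneg (abs_nonneg _) (sub_nonneg.mpr (hval (τ i) i (hτ i)).1)
  have hgap_nn : 0 ≤ b * (∑ i, |x i| - ∑ i, |x0 i|) := hgap ▸ Finset.sum_nonneg hnn
  have hsum : ∑ i, |x i| = ∑ i, |x0 i| :=
    le_antisymm hle (sub_nonneg.mp (nonneg_of_mul_nonneg_right hgap_nn hb))
  rw [hsum, sub_self, mul_zero, Finset.sum_eq_zero_iff_of_nonneg hnn] at hgap
  have hlam : ∀ j, ∃ f : Fin n → ℝ, (∀ i, 0 ≤ f i) ∧ (∀ i, i ∉ s → f i = 0) ∧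
      (x j ≠ 0 → ∑ i, f i = 1 ∧ ∑ i, f i • (σ i • A.transpose i) = τ j • A.transpose j) := by
    intro j
    by_cases hj : x j = 0
    · exact ⟨0, by simp, by simp, fun h => absurd hj h⟩
    · have hwj : w ⬝ᵥ (τ j • A.transpose j) = b := by
        have := (mul_eq_zero.mp (hgap j (Finset.mem_univ j))).resolve_left (abs_ne_zero.mpr hj)
        linarith
      obtain ⟨f, h1, h2, h3, h4⟩ := exists_weights_of_mem_convexHull s
        (fun i => σ i • A.transpose i) ((hval (τ j) j (hτ j)).2 hwj)
      exact ⟨f, h1, h2, fun _ => ⟨h3, h4⟩⟩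
  choose f hf hfs hfx using hlam
  have hcoord : (fun i => ∑ j, |x j| * f j i) = fun i => |x0 i| := by
    refine haff.weights_unique (p := fun i => σ i • A.transpose i) (fun i hi => ?_)
      (fun i hi => ?_) ?_ ?_
    · simp [hfs _ i hi]
    · simp [hs0 i hi]
    · rw [Finset.sum_comm, ← hsum]
      refine Finset.sum_congr rfl fun j _ => ?_
      rw [← Finset.mul_sum]
      by_cases hj : x j = 0
      · simp [hj]
      · rw [(hfx j hj).1, mul_one]
    · rw [← hx']
      simp only [Finset.sum_smul, mul_smul |_|]
      rw [Finset.sum_comm]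
      refine Finset.sum_congr rfl fun j _ => ?_
      rw [← Finset.smul_sum]
      by_cases hj : x j = 0
      · simp [hj]
      · rw [(hfx j hj).2]
  intro j hj0
  by_contra hj
  have hfj : ∀ i, x0 i = 0 → f j i = 0 := by
    intro i hi
    have h := congrFun hcoord i
    simp only [hi, abs_zero] at h
    rw [Finset.sum_eq_zero_iff_of_nonneg fun l _ => mul_nonneg (abs_nonneg _) (hf l i)] at h
    exact (mul_eq_zero.mp (h j (Finset.mem_univ j))).resolve_left (abs_ne_zero.mpr hj)
  have hc := eq_zero_of_card_lt_spark A (fun i => (Pi.single j (τ j) : Fin n → ℝ) i - f j i * σ i)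
    (insert j (Finset.univ.filter fun i => x0 i ≠ 0))
    (by
      simp only [sub_smul, mul_smul (f j _), Finset.sum_sub_distrib, (hfx j hj).2]
      simp [Pi.single_apply, ite_smul])
    (by
      intro i hi
      simp only [Finset.mem_insert, Finset.mem_filter, Finset.mem_univ, true_and, not_or,
        not_not] at hi
      simp [hi.1, hfj i hi.2])
    (lt_of_le_of_lt (by
      have := Finset.card_insert_le j (Finset.univ.filter fun i => x0 i ≠ 0)
      exact_mod_cast (by omega :
        (insert j (Finset.univ.filter fun i => x0 i ≠ 0)).card ≤ 2 * m)) hspark)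
  have hcj := congrFun hc j
  rcases hτ j with h | h <;> simp [h, hfj j hj0] at hcj

/-- **ℓ1/ℓ0 equivalence from neighbourliness and Spark.** If `P = conv{±a_i}` is
`k`-neighbourly (`k ≤ n`) and `x0` solves `A x0 = y` with `m ≤ k` nonzeros and
`2 m < Spark(A)`, then `x0` is both the unique sparsest solution and the unique ℓ1 minimizer. -/
theorem l1_l0_equivalence {d n : ℕ} (A : Matrix (Fin d) (Fin n) ℝ) (y : Fin d → ℝ)
    (x0 : Fin n → ℝ) (m k : ℕ)
    (hkn : k ≤ n)
    (hnb : Neighbourly A k)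
    (hy : A.mulVec x0 = y)
    (hm : (Finset.univ.filter fun i => x0 i ≠ 0).card = m)
    (hmk : m ≤ k)
    (hspark : ((2 * m : ℕ) : ℕ∞) < spark A) :
    (∀ x : Fin n → ℝ, A.mulVec x = y → x ≠ x0 →
        m < (Finset.univ.filter fun i => x i ≠ 0).card) ∧
      (∀ x : Fin n → ℝ, A.mulVec x = y → x ≠ x0 → ∑ i, |x0 i| < ∑ i, |x i|) := by
  have hcomb : ∀ x, A.mulVec x = y →
      ∑ i, x i • A.transpose i = ∑ i, x0 i • A.transpose i := fun x hx => by
    have h := hx.trans hy.symm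
    simpa only [Matrix.mulVec_eq_sum, op_smul_eq_smul] using h
  have huniq : ∀ x (T : Finset (Fin n)), A.mulVec x = y → T.card ≤ 2 * m →
      (∀ i, i ∉ T → x i = 0 ∧ x0 i = 0) → x = x0 := fun x T hx hT hz => by
    refine sub_eq_zero.mp (eq_zero_of_card_lt_spark A (x - x0) T ?_ (fun i hi => ?_)
      (lt_of_le_of_lt (by exact_mod_cast hT) hspark))
    · simp only [Pi.sub_apply, sub_smul, Finset.sum_sub_distrib, hcomb x hx, sub_self]
    · simp [hz i hi]
  refine ⟨fun x hx hne => ?_, fun x hx hne => ?_⟩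
  · by_contra! hle
    refine hne (huniq x ((Finset.univ.filter fun i => x i ≠ 0) ∪
      (Finset.univ.filter fun i => x0 i ≠ 0)) hx ?_ fun i hi => by simpa using hi)
    refine (Finset.card_union_le _ _).trans ?_
    omega
  · by_contra! hle
    refine hne (huniq x (Finset.univ.filter fun i => x0 i ≠ 0) hx (by omega) fun i hi => ?_)
    have hi0 : x0 i = 0 := by simpa using hi
    refine ⟨?_, hi0⟩
    rcases Nat.eq_zero_or_pos m with hm0 | hm0
    · have hx0 : ∀ i, x0 i = 0 := by
        rw [hm0, Finset.card_eq_zero, Finset.filter_eq_empty_iff] at hm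
        simpa using hm
      simp only [hx0, abs_zero, Finset.sum_const_zero] at hle
      have := (Finset.sum_eq_zero_iff_of_nonneg fun i _ => abs_nonneg (x i)).mp
        (le_antisymm hle (Finset.sum_nonneg fun i _ => abs_nonneg (x i)))
      exact abs_eq_zero.mp (this i (Finset.mem_univ i))
    · exact support_subset_of_sum_abs_le hkn hnb (hcomb x hx) hm hmk hm0 hspark hle i hi0
end
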